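/- Let $q$ be a prime power, let $n,s$ be positive integers with $\gcd(s,n)=1$, let $1\le k\le n-1$, let $h$ be an integer, and let $\eta\in\mathbb F_{q^n}^*$ satisfy $N_{q^n/q}(\eta)\neq(-1)^{nk}$. If $k=1$ or $k=n-1$, assume in addition that $h\not\equiv 0$ and $h\not\equiv sk \pmod n$. Polynomials $\sum_{i=0}^{n-1}a_ix^{q^i}$ over $\mathbb F_{q^n}$ ($q$-polynomials) are identified with the $\mathbb F_q$-linear maps of $\mathbb F_{q^n}$ that they define, exponents of $q$ being read modulo $n$; a code is a set of them. Two codes $\mathcal C,\mathcal C'$ are equivalent if $\mathcal C'=\{u\circ f^\sigma\circ v: f\in\mathcal C\}$ for some invertible $q$-polynomials $u,v$ and some automorphism $\sigma$ of $\mathbb F_{q^n}$ acting on coefficients. For $0\le d\le n-1$ and $\gcd(t,n)=1$ the generalized Gabidulin code of dimension $d$ is $\mathcal G_{d,t}=\langle x,x^{q^t},\dots,x^{q^{t(d-1)}}\rangle_{\mathbb F_{q^n}}$ (so $\mathcal G_{0,t}=\{0\}$), and the Gabidulin index of a code is the largest $d$ such that it contains a subcode equivalent to some $\mathcal G_{d,t}$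 with $\gcd(t,n)=1$. Let $$\mathcal H_{k,s}(\eta,h)=\{a_0x+a_1x^{q^s}+\dots+a_{k-1}x^{q^{s(k-1)}}+a_0^{q^h}\eta x^{q^{sk}}: a_i\in\mathbb F_{q^n}\}$$ be the generalized twisted Gabidulin code. Then the Gabidulin index of $\mathcal H_{k,s}(\eta,h)$ equals $k-1$: it contains the subcode $\{a_1x^{q^s}+\dots+a_{k-1}x^{q^{s(k-1)}}: a_i\in\mathbb F_{q^n}\}$, which is equivalent to $\mathcal G_{k-1,s}$, but it contains no subcode equivalent to a generalized Gabidulin code of dimension $k$. -/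

import Mathlib

/-! Linearized polynomials (`q`-polynomials) over a finite extension `F` of degree `n` of a
finite field `Fq` with `q` elements are represented by their coefficient vectors
`a : Fin n → F`, which stand for `∑ i, a i * x ^ (q ^ i)`. A rank distance code is a set of
such vectors. -/

section QPolyDefs

variable (Fq : Type*) [Field Fq] [Fintype Fq] {F : Type*} [Field F] [Fintype F]

/-- The map `F → F` given by the `q`-polynomial with coefficient vector `a`. -/
def qeval {n : ℕ} (a : Fin n → F) : F → F :=
  fun x => ∑ i : Fin n, a i * x ^ (Fintype.card Fq) ^ (i : ℕ)

/-- Composition of `q`-polynomials (reduced mod `x^(q^n) - x`), on coefficient vectors;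
the index `m - i` is computed modulo `n`. -/
def qcomp {n : ℕ} (a b : Fin n → F) : Fin n → F :=
  fun m => ∑ i : Fin n, a i * (b (m - i)) ^ (Fintype.card Fq) ^ (i : ℕ)

/-- `qcomp` is composition of the associated maps. -/
theorem qeval_qcomp [Algebra Fq F] {n : ℕ} (hn : Module.finrank Fq F = n)
    (a b : Fin n → F) (x : F) :
    qeval Fq (qcomp Fq a b) x = qeval Fq a (qeval Fq b x) := by
  have hn0 : 0 < n := hn ▸ Module.finrank_pos
  have : NeZero n := ⟨hn0.ne'⟩
  obtain ⟨p, hp⟩ := CharP.exists Fq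
  have := hp
  obtain ⟨e, hprime, hcard⟩ := FiniteField.card Fq p
  have : Fact p.Prime := ⟨hprime⟩
  have : CharP F p := charP_of_injective_algebraMap (algebraMap Fq F).injective p
  have hF : Fintype.card F = Fintype.card Fq ^ n := by
    rw [Module.card_eq_pow_finrank (K := Fq) (V := F), hn]
  have hper : ∀ (y : F) (m t : ℕ),
      y ^ (Fintype.card Fq) ^ (m + n * t) = y ^ (Fintype.card Fq) ^ m := by
    intro y m t
    rw [pow_add, pow_mul, pow_mul, ← hF, FiniteField.pow_card_pow]
  have hmod : ∀ (y : F) (m : ℕ),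
      y ^ (Fintype.card Fq) ^ (m % n) = y ^ (Fintype.card Fq) ^ m := by
    intro y m
    conv_rhs => rw [← Nat.mod_add_div m n]
    rw [hper]
  have hsum : ∀ (f : Fin n → F) (m : ℕ),
      (∑ i, f i) ^ (Fintype.card Fq) ^ m = ∑ i, f i ^ (Fintype.card Fq) ^ m := by
    intro f m
    rw [hcard, ← pow_mul, sum_pow_char_pow]
  simp only [qeval, qcomp, hsum, Finset.sum_mul, Finset.mul_sum]
  rw [Finset.sum_comm]
  refine Finset.sum_congr rfl fun i _ => ?_
  rw [← Equiv.sum_comp (Equiv.addRight i)]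
  refine Finset.sum_congr rfl fun j _ => ?_
  simp only [Equiv.coe_addRight, add_sub_cancel_right, Fin.val_add, hmod]
  rw [mul_pow, ← pow_mul, ← pow_add, mul_assoc]

/-- Equivalence of codes of `q`-polynomials: `C' = {u ∘ f^σ ∘ v : f ∈ C}` for invertible
`q`-polynomials `u, v` and a field automorphism `σ`, which acts on coefficients. -/
def CodeEquiv {n : ℕ} (C C' : Set (Fin n → F)) : Prop :=
  ∃ (u v : Fin n → F) (σ : F ≃+* F),
    Function.Bijective (qeval Fq u) ∧ Function.Bijective (qeval Fq v) ∧
    C' = (fun a => qcomp Fq u (qcomp Fq (fun i => σ (a i)) v)) '' C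

variable (F) in
/-- The generalized Gabidulin code `G_{k,s} = ⟨x, x^(q^s), …, x^(q^(s(k-1)))⟩_{F_{q^n}}`. -/
def Gcode (n s k : ℕ) : Set (Fin n → F) :=
  {a | ∃ c : Fin k → F, a = fun j : Fin n =>
    ∑ i : Fin k, if (j : ℕ) = (s * (i : ℕ)) % n then c i else 0}

variable (F) in
/-- The code `{a₁x^(q^s) + ⋯ + a_{k-1}x^(q^(s(k-1))) : aᵢ ∈ F_{q^n}}`. -/
def Gshift (n s k : ℕ) : Set (Fin n → F) :=
  {a | ∃ c : Fin (k - 1) → F, a = fun j : Fin n =>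
    ∑ i : Fin (k - 1), if (j : ℕ) = (s * ((i : ℕ) + 1)) % n then c i else 0}

/-- The generalized twisted Gabidulin code
`H_{k,s}(η,h) = {a₀x + a₁x^(q^s) + ⋯ + a_{k-1}x^(q^(s(k-1))) + a₀^(q^h) η x^(q^(sk))}`
(meant for `1 ≤ k`); the exponent `h` matters only modulo `n`. -/
def Hcode (n s k : ℕ) (h : ℤ) (η : F) : Set (Fin n → F) :=
  {a | ∃ c : Fin k → F, a = fun j : Fin n =>
    (∑ i : Fin k, if (j : ℕ) = (s * (i : ℕ)) % n then c i else 0) +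
    (if hk : 0 < k then
      (if (j : ℕ) = (s * k) % n then
        η * (c ⟨0, hk⟩) ^ (Fintype.card Fq) ^ (h % (n : ℤ)).toNat else 0)
    else 0)}

/-- `C` contains a subcode equivalent to a generalized Gabidulin code of dimension `d`
(that is, to some `G_{d,s}` with `gcd(s,n) = 1`). -/
def ContainsGabidulin {n : ℕ} (C : Set (Fin n → F)) (d : ℕ) : Prop :=
  ∃ G : Set (Fin n → F), G ⊆ C ∧
    ∃ s : ℕ, Nat.gcd s n = 1 ∧ CodeEquiv Fq G (Gcode F n s d)

/-- The Gabidulin index of a code: the maximum dimension `d ≤ n - 1` of a subcode equivalent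
to a generalized Gabidulin code. The set is bounded; `G_{0,s}` is the zero code. -/
noncomputable def gabidulinIndex {n : ℕ} (C : Set (Fin n → F)) : ℕ :=
  sSup {d : ℕ | d ≤ n - 1 ∧ ContainsGabidulin Fq C d}

end QPolyDefs

set_option linter.unusedSectionVars false

section FrobeniusPowers

variable (Fq : Type*) [Field Fq] [Fintype Fq] {F : Type*} [Field F] [Fintype F] [Algebra Fq F]
  {n : ℕ}

/-- The `q`-Frobenius power `x ↦ x ^ (q ^ i)` as an algebra endomorphism. -/
noncomputable def frobPow (i : Fin n) : F →ₐ[Fq] F :=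
  FiniteField.frobeniusAlgHom Fq F ^ (i : ℕ)

theorem frobPow_apply (i : Fin n) (x : F) :
    frobPow Fq i x = x ^ (Fintype.card Fq) ^ (i : ℕ) := by
  simp [frobPow, AlgHom.coe_pow, FiniteField.coe_frobeniusAlgHom, pow_iterate]

theorem qeval_eq_sum_frobPow (a : Fin n → F) (x : F) :
    qeval Fq a x = ∑ i, a i * frobPow Fq i x := by
  simp [qeval, frobPow_apply]

theorem qcomp_eq_sum_frobPow (a b : Fin n → F) (m : Fin n) :
    qcomp Fq a b m = ∑ i, a i * frobPow Fq i (b (m - i)) := by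
  simp [qcomp, frobPow_apply]

theorem frobPow_eq_zero (i : Fin n) {x : F} : frobPow Fq i x = 0 ↔ x = 0 :=
  map_eq_zero _

theorem frobPow_bijective (i : Fin n) : Function.Bijective (frobPow Fq i : F →ₐ[Fq] F) :=
  Finite.injective_iff_bijective.mp (frobPow Fq i : F →ₐ[Fq] F).toRingHom.injective


theorem frobPow_injective (hn : Module.finrank Fq F = n) :
    Function.Injective (frobPow Fq : Fin n → F →ₐ[Fq] F) := by
  subst hn
  exact (FiniteField.bijective_frobeniusAlgHom_pow Fq F).1

variable [NeZero n]

theorem frobPow_zero (x : F) : frobPow Fq (0 : Fin n) x = x := by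
  simp [frobPow]

theorem frobPow_add (hn : Module.finrank Fq F = n) (i j : Fin n) (x : F) :
    frobPow Fq (i + j) x = frobPow Fq i (frobPow Fq j x) := by
  have h : (frobPow Fq (i + j) : F →ₐ[Fq] F) = frobPow Fq i * frobPow Fq j := by
    rw [frobPow, frobPow, frobPow, ← pow_add, Fin.val_add]
    conv_rhs => rw [pow_eq_pow_mod (n := n) _
      (by rw [← hn, ← FiniteField.orderOf_frobeniusAlgHom, pow_orderOf_eq_one])]
  rw [h, AlgHom.mul_apply]

/-- Dedekind independence of the Frobenius powers. -/
theorem qeval_injective (hn : Module.finrank Fq F = n) :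
    Function.Injective (qeval Fq : (Fin n → F) → F → F) := by
  have hli := (linearIndependent_algHom_toLinearMap Fq F F).comp _ (frobPow_injective Fq hn)
  rw [Fintype.linearIndependent_iff] at hli
  intro a b hab
  ext i
  refine sub_eq_zero.mp (hli (fun i => a i - b i) ?_ i)
  ext x
  have := congrFun hab x
  simp only [qeval_eq_sum_frobPow] at this
  simp [sub_mul, Finset.sum_sub_distrib, this]

/-- Two distinct Frobenius powers are linearly independent over `F`. -/
theorem eq_zero_of_mul_frobPow_eq (hn : Module.finrank Fq F = n) {i j : Fin n} (hij : i ≠ j)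
    {A B : F} (h : ∀ x : F, A * frobPow Fq i x = B * frobPow Fq j x) : A = 0 ∧ B = 0 := by
  have : (Pi.single i A : Fin n → F) = Pi.single j B := by
    apply qeval_injective Fq hn
    ext x
    simpa [qeval_eq_sum_frobPow, Pi.single_apply, ite_mul] using h x
  have hi := congrFun this i
  have hj := congrFun this j
  simp [hij, hij.symm] at hi hj
  exact ⟨hi, hj.symm⟩

/-! ### The monoid of `q`-polynomials -/

theorem qcomp_assoc (hn : Module.finrank Fq F = n) (a b c : Fin n → F) :
    qcomp Fq (qcomp Fq a b) c = qcomp Fq a (qcomp Fq b c) := by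
  apply qeval_injective Fq hn
  ext x
  simp [qeval_qcomp Fq hn]

theorem qcomp_single_left (a : F) (j : Fin n) (f : Fin n → F) (m : Fin n) :
    qcomp Fq (Pi.single j a) f m = a * frobPow Fq j (f (m - j)) := by
  simp [qcomp_eq_sum_frobPow, Pi.single_apply, ite_mul]

theorem qcomp_single_right (a : F) (j : Fin n) (f : Fin n → F) (m : Fin n) :
    qcomp Fq f (Pi.single j a) m = f (m - j) * frobPow Fq (m - j) a := by
  rw [qcomp_eq_sum_frobPow, Finset.sum_eq_single (m - j)]
  · simp
  · intro i _ hi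
    have : m - i ≠ j := fun h => hi (by rw [← h]; abel)
    simp [this]
  · simp

theorem qcomp_one_left (f : Fin n → F) : qcomp Fq (Pi.single 0 1) f = f := by
  ext m
  simp [qcomp_single_left, frobPow_zero]

theorem qcomp_one_right (f : Fin n → F) : qcomp Fq f (Pi.single 0 1) = f := by
  ext m
  simp [qcomp_single_right]

theorem qcomp_add_left (f g w : Fin n → F) :
    qcomp Fq (f + g) w = qcomp Fq f w + qcomp Fq g w := by
  ext m
  simp [qcomp_eq_sum_frobPow, add_mul, Finset.sum_add_distrib]

theorem qcomp_add_right (f g w : Fin n → F) :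
    qcomp Fq f (g + w) = qcomp Fq f g + qcomp Fq f w := by
  ext m
  simp [qcomp_eq_sum_frobPow, mul_add, Finset.sum_add_distrib]

theorem bijective_qeval_single (j : Fin n) :
    Function.Bijective (qeval Fq (Pi.single j (1 : F))) := by
  have : qeval Fq (Pi.single j (1 : F)) = frobPow Fq j := by
    ext x
    simp [qeval_eq_sum_frobPow, Pi.single_apply, ite_mul]
  rw [this]
  exact frobPow_bijective Fq j

theorem exists_qcomp_inverse (hn : Module.finrank Fq F = n) {u : Fin n → F}
    (hu : Function.Bijective (qeval Fq u)) :
    ∃ w, qcomp Fq u w = Pi.single 0 1 ∧ qcomp Fq w u = Pi.single 0 1 := by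
  have hinj : Function.Injective (qcomp Fq u) := by
    intro a b hab
    apply qeval_injective Fq hn
    ext x
    apply hu.1
    rw [← qeval_qcomp Fq hn, hab, qeval_qcomp Fq hn]
  obtain ⟨w, hw⟩ := Finite.surjective_of_injective hinj (Pi.single 0 1)
  refine ⟨w, hw, hinj ?_⟩
  rw [← qcomp_assoc Fq hn, hw, qcomp_one_left, qcomp_one_right]

theorem map_qcomp (σ : F ≃+* F) (a b : Fin n → F) :
    (fun i => σ (qcomp Fq a b i)) = qcomp Fq (fun i => σ (a i)) (fun i => σ (b i)) := by
  ext m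
  simp [qcomp]

end FrobeniusPowers

/-! ### Positions of the exponents `s * m` modulo `n` -/

section Positions

variable {n : ℕ} [NeZero n]

/-- The class of `s * m` modulo `n`, as an index of coefficient vectors. -/
def multPos (n s : ℕ) [NeZero n] (m : ℤ) : Fin n := m • Fin.ofNat n s

theorem multPos_zero (s : ℕ) : multPos n s 0 = 0 := zero_smul _ _

theorem multPos_add (s : ℕ) (a b : ℤ) : multPos n s (a + b) = multPos n s a + multPos n s b :=
  add_smul _ _ _

theorem multPos_sub (s : ℕ) (a b : ℤ) : multPos n s (a - b) = multPos n s a - multPos n s b :=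
  sub_smul _ _ _

theorem val_multPos_natCast (s m : ℕ) : (multPos n s m : ℕ) = (s * m) % n := by
  rw [multPos, natCast_zsmul]
  induction m with
  | zero => simp
  | succ m ih => rw [succ_nsmul, Fin.val_add, ih, mul_add, mul_one, Fin.val_ofNat, ← Nat.add_mod]

theorem multPos_eq_iff {s : ℕ} (hs : Nat.gcd s n = 1) (a b : ℤ) :
    multPos n s a = multPos n s b ↔ (n : ℤ) ∣ a - b := by
  have hord : addOrderOf (Fin.ofNat n s) = n := by
    have key : ∀ m : ℕ, m • Fin.ofNat n s = 0 ↔ n ∣ m := by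
      intro m
      have := val_multPos_natCast (n := n) s m
      rw [multPos, natCast_zsmul] at this
      rw [Fin.ext_iff, this, Fin.val_zero, ← Nat.dvd_iff_mod_eq_zero]
      exact (Nat.Coprime.symm hs).dvd_mul_left
    apply Nat.dvd_antisymm
    · exact addOrderOf_dvd_iff_nsmul_eq_zero.mpr ((key n).mpr dvd_rfl)
    · exact (key _).mp (addOrderOf_nsmul_eq_zero _)
  rw [← sub_eq_zero, ← multPos_sub, multPos, ← addOrderOf_dvd_iff_zsmul_eq_zero, hord]

theorem multPos_congr {s : ℕ} (hs : Nat.gcd s n = 1) {a b : ℤ} (h : a = b + n) :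
    multPos n s a = multPos n s b :=
  (multPos_eq_iff hs a b).mpr ⟨1, by rw [h]; ring⟩

theorem multPos_ne {s : ℕ} (hs : Nat.gcd s n = 1) {a b : ℤ} (h1 : a < b) (h2 : b < a + n) :
    multPos n s a ≠ multPos n s b := by
  intro h
  rw [multPos_eq_iff hs, ← dvd_neg] at h
  have := Int.le_of_dvd (by omega) h
  omega

theorem multPos_natCast_injOn {s : ℕ} (hs : Nat.gcd s n = 1) {a b : ℕ} (ha : a < n) (hb : b < n)
    (h : multPos n s a = multPos n s b) : a = b := by
  rcases lt_trichotomy a b with hab | hab | hab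
  · exact absurd h (multPos_ne hs (by omega) (by omega))
  · exact hab
  · exact absurd h.symm (multPos_ne hs (by omega) (by omega))

theorem bijective_multPos {s : ℕ} (hs : Nat.gcd s n = 1) :
    Function.Bijective fun i : Fin n => multPos n s (i : ℕ) :=
  Finite.injective_iff_bijective.mp fun i j h =>
    Fin.ext (multPos_natCast_injOn hs i.2 j.2 h)

theorem exists_multPos_eq {s : ℕ} (hs : Nat.gcd s n = 1) (i : Fin n) :
    ∃ m : ℕ, m < n ∧ multPos n s m = i := by
  obtain ⟨m, hm⟩ := (bijective_multPos hs).2 i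
  exact ⟨m, m.2, hm⟩

theorem val_eq_mod_iff (s m : ℕ) (j : Fin n) : (j : ℕ) = (s * m) % n ↔ j = multPos n s m := by
  rw [Fin.ext_iff, val_multPos_natCast]

end Positions

/-! ### Membership in the codes, and their sizes -/

section Codes

variable {F : Type*} [Field F] [Fintype F] {n : ℕ} [NeZero n]

theorem sum_ite_apply_of_injective {d : ℕ} {P : Fin d → Fin n} (hP : Function.Injective P)
    (c : Fin d → F) (i : Fin d) : (∑ l, if P i = P l then c l else 0) = c i := by
  simp [hP.eq_iff]

theorem exists_eq_sum_ite_iff {d : ℕ} {P : Fin d → Fin n} (hP : Function.Injective P)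
    (g : Fin n → F) :
    (∃ c : Fin d → F, g = fun j => ∑ i, if j = P i then c i else 0) ↔
      ∀ j, (∀ i, j ≠ P i) → g j = 0 := by
  constructor
  · rintro ⟨c, rfl⟩ j hj
    simp [hj]
  · intro h
    refine ⟨fun i => g (P i), ?_⟩
    ext j
    by_cases hj : ∃ i, j = P i
    · obtain ⟨i, rfl⟩ := hj
      rw [sum_ite_apply_of_injective hP (fun i => g (P i))]
    · push Not at hj
      simp [h j hj, hj]

theorem injective_multPos_fin {s d : ℕ} (hs : Nat.gcd s n = 1) (hd : d ≤ n) :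
    Function.Injective fun i : Fin d => multPos n s (i : ℕ) := fun i j h =>
  Fin.ext (multPos_natCast_injOn hs (i.2.trans_le hd) (j.2.trans_le hd) h)

theorem mem_Gcode_iff {s d : ℕ} (hs : Nat.gcd s n = 1) (hd : d ≤ n) (g : Fin n → F) :
    g ∈ Gcode F n s d ↔ ∀ m : ℕ, d ≤ m → m < n → g (multPos n s m) = 0 := by
  simp only [Gcode, Set.mem_ofPred_eq, val_eq_mod_iff]
  rw [exists_eq_sum_ite_iff (injective_multPos_fin hs hd)]
  constructor
  · intro h m hdm hmn
    refine h _ fun i hi => ?_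
    have := multPos_natCast_injOn hs hmn (i.2.trans_le hd) hi
    omega
  · intro h j hj
    obtain ⟨m, hm, rfl⟩ := exists_multPos_eq hs j
    exact h m (by by_contra! hlt; exact hj ⟨m, hlt⟩ rfl) hm

theorem mem_Gshift_iff {s k : ℕ} (hs : Nat.gcd s n = 1) (hk : k ≤ n) (hk1 : 1 ≤ k)
    (g : Fin n → F) :
    g ∈ Gshift F n s k ↔ g 0 = 0 ∧ ∀ m : ℕ, k ≤ m → m < n → g (multPos n s m) = 0 := by
  simp only [Gshift, Set.mem_ofPred_eq, val_eq_mod_iff]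
  have hP : Function.Injective fun i : Fin (k - 1) => multPos n s ((i + 1 : ℕ) : ℤ) :=
    fun i j h => Fin.ext (by
      have := multPos_natCast_injOn hs (by omega) (by omega) h
      omega)
  rw [exists_eq_sum_ite_iff hP]
  constructor
  · intro h
    refine ⟨h _ fun i hi => ?_, fun m hdm hmn => h _ fun i hi => ?_⟩
    · rw [← multPos_zero s] at hi
      exact multPos_ne hs (by omega) (by omega) hi
    · have := multPos_natCast_injOn hs hmn (by omega) hi
      omega
  · rintro ⟨h0, h⟩ j hj
    obtain ⟨m, hm, rfl⟩ := exists_multPos_eq hs j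
    rcases Nat.eq_zero_or_pos m with rfl | hpos
    · simpa [multPos_zero] using h0
    · refine h m ?_ hm
      by_contra! hlt
      exact hj ⟨m - 1, by omega⟩ (by simp only; congr 2; omega)

theorem ncard_Gcode {s d : ℕ} (hs : Nat.gcd s n = 1) (hd : d ≤ n) :
    (Gcode F n s d).ncard = Fintype.card F ^ d := by
  have hrange : Gcode F n s d = Set.range fun c : Fin d → F => fun j : Fin n =>
      ∑ i : Fin d, if j = multPos n s (i : ℕ) then c i else 0 := by
    ext g
    simp only [Gcode, Set.mem_ofPred_eq, val_eq_mod_iff, Set.mem_range, eq_comm]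
  rw [hrange, ← Set.image_univ, Set.ncard_image_of_injective, Set.ncard_univ]
  · simp
  · intro c c' h
    ext i
    have := congrFun h (multPos n s (i : ℕ))
    simpa only [sum_ite_apply_of_injective (injective_multPos_fin hs hd)] using this

theorem Gshift_subset_Hcode (Fq : Type*) [Field Fq] [Fintype Fq] {s k : ℕ} (h : ℤ)
    (hs : Nat.gcd s n = 1) (hk1 : 1 ≤ k) (hk : k < n) (η : F) :
    Gshift F n s k ⊆ Hcode Fq n s k h η := by
  intro g hg
  have hG : g ∈ Gcode F n s k := (mem_Gcode_iff hs hk.le g).mpr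
    ((mem_Gshift_iff hs hk.le hk1 g).mp hg).2
  have h0 := ((mem_Gshift_iff hs hk.le hk1 g).mp hg).1
  obtain ⟨c, rfl⟩ := hG
  have hc : c ⟨0, hk1⟩ = 0 := by
    rw [← h0, ← sum_ite_apply_of_injective (injective_multPos_fin hs hk.le) c ⟨0, hk1⟩]
    simp only [val_eq_mod_iff, Nat.cast_zero, multPos_zero]
  refine ⟨c, ?_⟩
  ext j
  simp [hc]

theorem ncard_Hcode_le (Fq : Type*) [Field Fq] [Fintype Fq] (s k : ℕ) (h : ℤ) (η : F) :
    (Hcode Fq n s k h η).ncard ≤ Fintype.card F ^ k := by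
  have hrange : Hcode Fq n s k h η = (fun c : Fin k → F => fun j : Fin n =>
    (∑ i : Fin k, if (j : ℕ) = (s * (i : ℕ)) % n then c i else 0) +
    (if hk : 0 < k then
      (if (j : ℕ) = (s * k) % n then
        η * (c ⟨0, hk⟩) ^ (Fintype.card Fq) ^ (h % (n : ℤ)).toNat else 0)
    else 0)) '' Set.univ := by
    ext g
    simp only [Hcode, Set.mem_ofPred_eq, Set.image_univ, Set.mem_range, eq_comm]
  rw [hrange]
  refine (Set.ncard_image_le).trans ?_
  simp [Set.ncard_univ]

/-- The class of the integer `h` modulo `n`. -/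
def intPos (n : ℕ) [NeZero n] (h : ℤ) : Fin n :=
  ⟨(h % (n : ℤ)).toNat, by
    have hpos : (0 : ℤ) < n := by exact_mod_cast Nat.pos_of_neZero n
    have := Int.emod_lt_of_pos h hpos
    have := Int.emod_nonneg h hpos.ne'
    omega⟩

theorem intPos_eq_iff (h h' : ℤ) : intPos n h = intPos n h' ↔ h ≡ h' [ZMOD n] := by
  have hpos : (0 : ℤ) < n := by exact_mod_cast Nat.pos_of_neZero n
  have h1 := Int.emod_nonneg h hpos.ne'
  have h2 := Int.emod_nonneg h' hpos.ne'
  simp only [intPos, Fin.mk.injEq, Int.ModEq]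
  omega

theorem intPos_mul (s k : ℕ) : intPos n ((s : ℤ) * k) = multPos n s k := by
  rw [Fin.ext_iff, val_multPos_natCast, intPos]
  norm_cast

theorem intPos_zero : intPos n 0 = 0 := by
  simp [intPos]

theorem mem_Hcode_iff (Fq : Type*) [Field Fq] [Fintype Fq] [Algebra Fq F] {s k : ℕ} (h : ℤ)
    (hs : Nat.gcd s n = 1) (hk1 : 1 ≤ k) (hk : k < n) (η : F) (g : Fin n → F) :
    g ∈ Hcode Fq n s k h η ↔
      (∀ m : ℕ, k < m → m < n → g (multPos n s m) = 0) ∧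
      g (multPos n s k) = η * frobPow Fq (intPos n h) (g 0) := by
  have hP := injective_multPos_fin (n := n) hs hk.le
  have hpow : ∀ x : F, x ^ (Fintype.card Fq) ^ (h % (n : ℤ)).toNat =
      frobPow Fq (intPos n h) x := fun x => by rw [frobPow_apply]; rfl
  have hk0 : 0 < k := hk1
  have hz : ∀ m : ℕ, k ≤ m → m < n → ∀ i : Fin k, multPos n s m ≠ multPos n s (i : ℕ) := by
    intro m hkm hmn i hi
    have := multPos_natCast_injOn hs hmn (i.2.trans hk) hi
    omega
  have hsum : ∀ (c : Fin k → F) (i : Fin k), (∑ l : Fin k,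
      if multPos n s (i : ℕ) = multPos n s (l : ℕ) then c l else 0) = c i :=
    sum_ite_apply_of_injective hP
  have hne : ∀ i : Fin k, multPos n s (i : ℕ) ≠ multPos n s k := fun i h => hz k le_rfl hk i h.symm
  simp only [Hcode, Set.mem_ofPred_eq, val_eq_mod_iff, hpow, hk0, dif_pos]
  constructor
  · rintro ⟨c, rfl⟩
    refine ⟨fun m hkm hmn => ?_, ?_⟩
    · have : multPos n s m ≠ multPos n s k := fun h => by
        have := multPos_natCast_injOn hs hmn hk h
        omega
      simp [hz m hkm.le hmn, this]
    · have h0 := hsum c ⟨0, hk0⟩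
      have h0' := hne ⟨0, hk0⟩
      simp only [Nat.cast_zero, multPos_zero] at h0 h0'
      simp [hz k le_rfl hk, h0, h0']
  · rintro ⟨h1, h2⟩
    refine ⟨fun i => g (multPos n s (i : ℕ)), ?_⟩
    ext j
    obtain ⟨m, hm, rfl⟩ := exists_multPos_eq hs j
    rcases lt_trichotomy m k with hmk | rfl | hmk
    · have e := hsum (fun i => g (multPos n s (i : ℕ))) ⟨m, hmk⟩
      have e' := hne ⟨m, hmk⟩
      simp only at e e'
      simp [e, e']
    · simp [hz m le_rfl hk, h2, multPos_zero]
    · have : multPos n s m ≠ multPos n s k := fun h => by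
        have := multPos_natCast_injOn hs hm hk h
        omega
      simp [hz m hmk.le hm, this, h1 m hmk hm]

theorem codeEquiv_Gshift_Gcode (Fq : Type*) [Field Fq] [Fintype Fq] [Algebra Fq F] {s k : ℕ}
    (hs : Nat.gcd s n = 1) (hk1 : 1 ≤ k) (hk : k < n) :
    CodeEquiv Fq (Gshift F n s k) (Gcode F n s (k - 1)) := by
  refine ⟨Pi.single 0 1, Pi.single (-multPos n s 1) 1, RingEquiv.refl F,
    bijective_qeval_single Fq _, bijective_qeval_single Fq _, ?_⟩
  have hcomp : ∀ (a : Fin n → F), qcomp Fq (Pi.single 0 1)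
      (qcomp Fq (fun i => (RingEquiv.refl F) (a i)) (Pi.single (-multPos n s 1) 1)) =
      fun m => a (m + multPos n s 1) := by
    intro a
    rw [qcomp_one_left]
    ext m
    simp [qcomp_single_right]
  simp only [hcomp]
  ext g
  rw [mem_Gcode_iff hs (by omega)]
  constructor
  · intro hg
    refine ⟨fun m => g (m - multPos n s 1), ?_, by simp⟩
    rw [mem_Gshift_iff hs hk.le hk1]
    refine ⟨?_, fun m hkm hmn => ?_⟩
    · rw [← multPos_zero s, ← multPos_sub,
        ← multPos_congr hs (a := ((n - 1 : ℕ) : ℤ)) (by push_cast [show 1 ≤ n by omega]; ring)]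
      exact hg _ (by omega) (by omega)
    · rw [← multPos_sub, show (m : ℤ) - 1 = ((m - 1 : ℕ) : ℤ) by omega]
      exact hg _ (by omega) (by omega)
  · rintro ⟨a, ha, rfl⟩ m hkm hmn
    rw [mem_Gshift_iff hs hk.le hk1] at ha
    simp only
    rw [← multPos_add]
    rcases Nat.lt_or_ge (m + 1) n with hlt | hge
    · exact_mod_cast ha.2 (m + 1) (by omega) hlt
    · rw [multPos_congr hs (b := 0) (by omega), multPos_zero]
      exact ha.1

end Codes

/-! ### Idealizers of codes equivalent to generalized Gabidulin codes -/

section Idealizers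

variable (Fq : Type*) [Field Fq] [Fintype Fq] {F : Type*} [Field F] [Fintype F] [Algebra Fq F]
  {n : ℕ} [NeZero n]

theorem CodeEquiv.map_injective (hn : Module.finrank Fq F = n) {u v : Fin n → F} (σ : F ≃+* F)
    (hu : Function.Bijective (qeval Fq u)) (hv : Function.Bijective (qeval Fq v)) :
    Function.Injective fun a : Fin n → F => qcomp Fq u (qcomp Fq (fun i => σ (a i)) v) := by
  obtain ⟨u', -, hu'⟩ := exists_qcomp_inverse Fq hn hu
  obtain ⟨v', hv', -⟩ := exists_qcomp_inverse Fq hn hv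
  intro a b hab
  have h1 := congrArg (fun w => qcomp Fq (qcomp Fq u' w) v') hab
  simp only [← qcomp_assoc Fq hn, hu', qcomp_one_left] at h1
  simp only [qcomp_assoc Fq hn, hv', qcomp_one_right] at h1
  ext i
  exact σ.injective (congrFun h1 i)

theorem Gcode_qcomp_scalar_left {t d : ℕ} (ht : Nat.gcd t n = 1) (hd : d ≤ n) (b : F)
    {g : Fin n → F} (hg : g ∈ Gcode F n t d) : qcomp Fq (Pi.single 0 b) g ∈ Gcode F n t d := by
  rw [mem_Gcode_iff ht hd] at hg ⊢
  intro m h1 h2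
  simp [qcomp_single_left, hg m h1 h2]

theorem Gcode_qcomp_scalar_right {t d : ℕ} (ht : Nat.gcd t n = 1) (hd : d ≤ n) (b : F)
    {g : Fin n → F} (hg : g ∈ Gcode F n t d) : qcomp Fq g (Pi.single 0 b) ∈ Gcode F n t d := by
  rw [mem_Gcode_iff ht hd] at hg ⊢
  intro m h1 h2
  simp [qcomp_single_right, hg m h1 h2]

theorem CodeEquiv.exists_injective_leftIdealizer (hn : Module.finrank Fq F = n) {t d : ℕ}
    (ht : Nat.gcd t n = 1) (hd : d ≤ n) {C : Set (Fin n → F)}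
    (hC : CodeEquiv Fq C (Gcode F n t d)) :
    ∃ Φ : F → Fin n → F, Function.Injective Φ ∧ ∀ b, ∀ g ∈ C, qcomp Fq (Φ b) g ∈ C := by
  obtain ⟨u, v, σ, hu, hv, hG⟩ := hC
  obtain ⟨u', huu', -⟩ := exists_qcomp_inverse Fq hn hu
  have hinj := CodeEquiv.map_injective Fq hn σ hu hv
  refine ⟨fun b i => σ.symm (qcomp Fq u' (qcomp Fq (Pi.single 0 b) u) i), ?_, ?_⟩
  · intro b c hbc
    have h1 : qcomp Fq u' (qcomp Fq (Pi.single 0 b) u) =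
        qcomp Fq u' (qcomp Fq (Pi.single 0 c) u) := by
      ext i
      exact σ.symm.injective (congrFun hbc i)
    have h2 := congrArg (fun w => qcomp Fq (qcomp Fq u w) u') h1
    simp only [← qcomp_assoc Fq hn, huu', qcomp_one_left] at h2
    simp only [qcomp_assoc Fq hn, huu', qcomp_one_right] at h2
    simpa using congrFun h2 0
  · intro b g hg
    have hmem : qcomp Fq u (qcomp Fq (fun i => σ (g i)) v) ∈ Gcode F n t d := by
      rw [hG]; exact ⟨g, hg, rfl⟩
    have hmem' := Gcode_qcomp_scalar_left Fq ht hd b hmem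
    rw [hG] at hmem'
    obtain ⟨g', hg', heq⟩ := hmem'
    convert! hg'
    apply hinj
    simp only [heq, map_qcomp, RingEquiv.apply_symm_apply]
    simp only [← qcomp_assoc Fq hn, huu', qcomp_one_left]

theorem CodeEquiv.exists_injective_rightIdealizer (hn : Module.finrank Fq F = n) {t d : ℕ}
    (ht : Nat.gcd t n = 1) (hd : d ≤ n) {C : Set (Fin n → F)}
    (hC : CodeEquiv Fq C (Gcode F n t d)) :
    ∃ Φ : F → Fin n → F, Function.Injective Φ ∧ ∀ b, ∀ g ∈ C, qcomp Fq g (Φ b) ∈ C := by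
  obtain ⟨u, v, σ, hu, hv, hG⟩ := hC
  obtain ⟨v', -, hv'v⟩ := exists_qcomp_inverse Fq hn hv
  have hinj := CodeEquiv.map_injective Fq hn σ hu hv
  refine ⟨fun b i => σ.symm (qcomp Fq v (qcomp Fq (Pi.single 0 b) v') i), ?_, ?_⟩
  · intro b c hbc
    have h1 : qcomp Fq v (qcomp Fq (Pi.single 0 b) v') =
        qcomp Fq v (qcomp Fq (Pi.single 0 c) v') := by
      ext i
      exact σ.symm.injective (congrFun hbc i)
    have h2 := congrArg (fun w => qcomp Fq (qcomp Fq v' w) v) h1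
    simp only [← qcomp_assoc Fq hn, hv'v, qcomp_one_left] at h2
    simp only [qcomp_assoc Fq hn, hv'v, qcomp_one_right] at h2
    simpa using congrFun h2 0
  · intro b g hg
    have hmem : qcomp Fq u (qcomp Fq (fun i => σ (g i)) v) ∈ Gcode F n t d := by
      rw [hG]; exact ⟨g, hg, rfl⟩
    have hmem' := Gcode_qcomp_scalar_right Fq ht hd b hmem
    rw [hG] at hmem'
    obtain ⟨g', hg', heq⟩ := hmem'
    convert! hg'
    apply hinj
    simp only [heq, map_qcomp, RingEquiv.apply_symm_apply]
    simp only [qcomp_assoc Fq hn, hv'v, qcomp_one_right]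

theorem exists_eq_single_of_injective {Φ : F → Fin n → F} (hΦ : Function.Injective Φ)
    (h0 : ∀ b i, i ≠ 0 → Φ b i = 0) (b : F) : ∃ c, Φ c = Pi.single 0 b := by
  have hsingle : ∀ c, Φ c = Pi.single 0 (Φ c 0) := by
    intro c
    ext i
    by_cases hi : i = 0
    · subst hi; simp
    · simp [hi, h0 c i hi]
  have hinj : Function.Injective fun c => Φ c 0 := by
    intro c c' h
    apply hΦ
    rw [hsingle c, hsingle c']
    exact congrArg _ h
  obtain ⟨c, hc⟩ := Finite.surjective_of_injective hinj b
  exact ⟨c, by rw [hsingle c]; exact congrArg _ hc⟩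

theorem le_and_eq_of_subset_of_codeEquiv {t d k : ℕ}
    (ht : Nat.gcd t n = 1) (hd : d ≤ n) {C G : Set (Fin n → F)}
    (hcard : C.ncard ≤ Fintype.card F ^ k) (hGC : G ⊆ C)
    (hG : CodeEquiv Fq G (Gcode F n t d)) : d ≤ k ∧ (d = k → G = C) := by
  obtain ⟨u, v, σ, hu, hv, h⟩ := hG
  have h1 : Fintype.card F ^ d ≤ G.ncard := by
    rw [← ncard_Gcode ht hd, h]
    exact Set.ncard_image_le
  have h2 : G.ncard ≤ C.ncard := Set.ncard_le_ncard hGC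
  refine ⟨(Nat.pow_le_pow_iff_right Fintype.one_lt_card).mp (h1.trans (h2.trans hcard)), ?_⟩
  rintro rfl
  exact Set.eq_of_subset_of_ncard_le hGC (hcard.trans h1)

end Idealizers

/-! ### Idealizers of generalized twisted Gabidulin codes -/

section TwistedIdealizers

variable (Fq : Type*) [Field Fq] [Fintype Fq] {F : Type*} [Field F] [Fintype F] [Algebra Fq F]
  {n s k : ℕ} [NeZero n]

theorem single_mem_Hcode (h : ℤ) (hs : Nat.gcd s n = 1) (hk : k < n) (η a : F) {j : ℕ}
    (hj1 : 1 ≤ j) (hjk : j < k) : Pi.single (multPos n s j) a ∈ Hcode Fq n s k h η := by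
  rw [mem_Hcode_iff Fq h hs (by omega) hk]
  have hne : ∀ m : ℕ, k ≤ m → m < n → multPos n s m ≠ multPos n s j := fun m h1 h2 =>
    (multPos_ne hs (by omega) (by omega)).symm
  have hne0 : (0 : Fin n) ≠ multPos n s j := by
    rw [← multPos_zero s]
    exact multPos_ne hs (by omega) (by omega)
  refine ⟨fun m h1 h2 => by simp [hne m h1.le h2], ?_⟩
  simp [hne k le_rfl hk, hne0]

theorem twist_mem_Hcode (h : ℤ) (hs : Nat.gcd s n = 1) (hk1 : 1 ≤ k) (hk : k < n) (η a : F) :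
    Pi.single 0 a + Pi.single (multPos n s k) (η * frobPow Fq (intPos n h) a)
      ∈ Hcode Fq n s k h η := by
  rw [mem_Hcode_iff Fq h hs hk1 hk]
  have hne0 : ∀ m : ℕ, k ≤ m → m < n → multPos n s m ≠ 0 := by
    intro m h1 h2
    rw [← multPos_zero s]
    exact (multPos_ne hs (by omega) (by omega)).symm
  refine ⟨fun m h1 h2 => ?_, ?_⟩
  · have : multPos n s m ≠ multPos n s k := (multPos_ne hs (by omega) (by omega)).symm
    simp [hne0 m h1.le h2, this]
  · simp [hne0 k le_rfl hk, (hne0 k le_rfl hk).symm]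

/-- A coefficient vector annihilated on all windows `(k - j, n - j)`, `1 ≤ j < k`, is supported
on the exponents `-1, 0, 1`. -/
theorem eq_zero_of_windows (hk2 : 2 ≤ k) (hkn : k + 2 ≤ n) {f : Fin n → F}
    (hf : ∀ j m : ℕ, 1 ≤ j → j < k → k < m → m < n → f (multPos n s ((m : ℤ) - j)) = 0)
    {i : ℤ} (hi2 : 2 ≤ i) (hin : i + 2 ≤ n) : f (multPos n s i) = 0 := by
  lift i to ℕ using by omega
  have := hf (max 1 (k + 1 - i)) (i + max 1 (k + 1 - i)) (by omega) (by omega) (by omega)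
    (by omega)
  rwa [Nat.cast_add, add_sub_cancel_right] at this

theorem eq_zero_off_zero (hs : Nat.gcd s n = 1) {f : Fin n → F}
    (hf : ∀ m : ℕ, 1 ≤ m → m < n → f (multPos n s m) = 0) (i : Fin n) (hi : i ≠ 0) : f i = 0 := by
  obtain ⟨m, hm, rfl⟩ := exists_multPos_eq hs i
  refine hf m (Nat.one_le_iff_ne_zero.mpr ?_) hm
  rintro rfl
  exact hi (multPos_zero s)

/-- In degree four, the norm condition forces the only possible obstruction to vanish. -/
theorem eq_zero_of_norm_ne_one (hn : Module.finrank Fq F = 4) (hs : Nat.gcd s 4 = 1) {η c : F}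
    (hη : Algebra.norm Fq η ≠ 1)
    (hc : c = -(η * frobPow Fq (multPos 4 s 3) η * frobPow Fq (multPos 4 s 2) c)) : c = 0 := by
  have hN : algebraMap Fq F (Algebra.norm Fq η) =
      η * frobPow Fq (multPos 4 s 1) η * frobPow Fq (multPos 4 s 2) η *
        frobPow Fq (multPos 4 s 3) η := by
    rw [FiniteField.algebraMap_norm_eq_prod_pow, hn, Finset.prod_range]
    have := (bijective_multPos (n := 4) hs).prod_comp fun i => frobPow Fq i η
    simp only [frobPow_apply (n := 4) Fq _ η] at this
    rw [Nat.card_eq_fintype_card, ← this, Fin.prod_univ_four]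
    simp [frobPow_apply, multPos_zero]
  have h2 : frobPow Fq (multPos 4 s 2) c =
      -(frobPow Fq (multPos 4 s 2) η * frobPow Fq (multPos 4 s 1) η * c) := by
    conv_lhs => rw [hc]
    simp only [map_neg, map_mul, ← frobPow_add Fq hn, ← multPos_add]
    rw [multPos_congr hs (a := 2 + 3) (b := 1) (by norm_num),
      multPos_congr hs (a := 2 + 2) (b := 0) (by norm_num), multPos_zero, frobPow_zero]
  have h3 : (algebraMap Fq F (Algebra.norm Fq η) - 1) * c = 0 := by
    rw [hN]
    rw [h2] at hc
    linear_combination -hc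
  rcases mul_eq_zero.mp h3 with h4 | h4
  · exact absurd ((algebraMap Fq F).injective (by rw [map_one]; exact sub_eq_zero.mp h4)) hη
  · exact h4

theorem leftIdealizer_Hcode (hn : Module.finrank Fq F = n) (h : ℤ) (hs : Nat.gcd s n = 1)
    (hk1 : 1 ≤ k) (hk : k < n) {η : F} (hη : η ≠ 0)
    (hnorm : Algebra.norm Fq η ≠ (-1 : Fq) ^ (n * k))
    (hext : k = 1 ∨ k = n - 1 → intPos n h ≠ 0 ∧ intPos n h ≠ multPos n s k)
    {f : Fin n → F} (hf : ∀ g ∈ Hcode Fq n s k h η, qcomp Fq f g ∈ Hcode Fq n s k h η) :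
    ∀ i, i ≠ 0 → f i = 0 := by
  set r := intPos n h with hr
  have hA : ∀ j m : ℕ, 1 ≤ j → j < k → k < m → m < n →
      f (multPos n s ((m : ℤ) - j)) = 0 := by
    intro j m hj1 hjk hkm hmn
    have := hf _ (single_mem_Hcode Fq h hs hk η 1 hj1 hjk)
    rw [mem_Hcode_iff Fq h hs hk1 hk] at this
    simpa [qcomp_single_right, multPos_sub] using this.1 m hkm hmn
  have hA2 : ∀ j : ℕ, 1 ≤ j → j < k → ∀ a : F,
      f (multPos n s ((k : ℤ) - j)) * frobPow Fq (multPos n s ((k : ℤ) - j)) a =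
      η * frobPow Fq r (f (multPos n s (-j))) * frobPow Fq (r + multPos n s (-j)) a := by
    intro j hj1 hjk a
    have := hf _ (single_mem_Hcode Fq h hs hk η a hj1 hjk)
    rw [mem_Hcode_iff Fq h hs hk1 hk] at this
    have := this.2
    rw [qcomp_single_right, qcomp_single_right, ← multPos_zero s, ← multPos_sub, ← multPos_sub,
      map_mul, zero_sub, ← frobPow_add Fq hn, ← mul_assoc] at this
    exact this
  have hA2' : ∀ j : ℕ, 1 ≤ j → j < k → r ≠ multPos n s k →
      f (multPos n s ((k : ℤ) - j)) = 0 ∧ f (multPos n s (-j)) = 0 := by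
    intro j hj1 hjk hrk
    have hne : multPos n s ((k : ℤ) - j) ≠ r + multPos n s (-j) := by
      rw [sub_eq_add_neg, multPos_add]
      exact fun h => hrk (add_right_cancel h).symm
    have := eq_zero_of_mul_frobPow_eq Fq hn hne (hA2 j hj1 hjk)
    simpa [hη, frobPow_eq_zero] using this
  have hA2'' : ∀ j : ℕ, 1 ≤ j → j < k →
      f (multPos n s ((k : ℤ) - j)) = η * frobPow Fq r (f (multPos n s (-j))) := by
    intro j hj1 hjk
    simpa using hA2 j hj1 hjk 1
  have hB : ∀ m : ℕ, k < m → m < n → ∀ a : F,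
      f (multPos n s m) * frobPow Fq (multPos n s m) a =
      -(f (multPos n s ((m : ℤ) - k)) * frobPow Fq (multPos n s ((m : ℤ) - k)) η) *
        frobPow Fq (multPos n s ((m : ℤ) - k) + r) a := by
    intro m hkm hmn a
    have := hf _ (twist_mem_Hcode Fq h hs hk1 hk η a)
    rw [mem_Hcode_iff Fq h hs hk1 hk] at this
    have := this.1 m hkm hmn
    rw [qcomp_add_right, Pi.add_apply, qcomp_single_right, qcomp_single_right, sub_zero,
      ← multPos_sub, map_mul, ← frobPow_add Fq hn] at this
    linear_combination this
  refine eq_zero_off_zero hs fun i hi1 hin => ?_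
  by_cases hk1' : k = 1
  · subst hk1'
    obtain ⟨hr0, hr1⟩ := hext (Or.inl rfl)
    have key : ∀ m : ℕ, 1 < m → m < n →
        f (multPos n s m) = 0 ∧ f (multPos n s ((m : ℤ) - 1)) = 0 := by
      intro m h1 h2
      have hne : multPos n s m ≠ multPos n s ((m : ℤ) - (1 : ℕ)) + r := by
        intro he
        apply hr1
        rw [multPos_sub] at he
        rw [sub_add, eq_comm, sub_eq_self, sub_eq_zero] at he
        exact he.symm
      have := eq_zero_of_mul_frobPow_eq Fq hn hne (hB m h1 h2)
      refine ⟨this.1, ?_⟩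
      have := neg_eq_zero.mp this.2
      simpa [frobPow_eq_zero, hη] using this
    by_cases hi : 1 < i
    · exact (key i hi hin).1
    · obtain rfl : i = 1 := by omega
      by_cases hn2 : 2 < n
      · simpa using (key 2 (by omega) hn2).2
      · exfalso
        obtain rfl : n = 2 := by omega
        have hs1 : multPos 2 s (1 : ℕ) ≠ 0 := by
          rw [← multPos_zero s]
          exact (multPos_ne hs (by omega) (by omega)).symm
        generalize multPos 2 s (1 : ℕ) = x at *
        generalize r = y at *
        omega
  by_cases hkn : k = n - 1
  · obtain ⟨hr0, hr1⟩ := hext (Or.inr hkn)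
    by_cases hi : i = 1
    · subst hi
      have := (hA2' (k - 1) (by omega) (by omega) hr1).1
      rwa [show (k : ℤ) - (k - 1 : ℕ) = (1 : ℕ) by omega] at this
    · have := (hA2' (n - i) (by omega) (by omega) hr1).2
      rwa [← multPos_congr hs (a := i) (by omega)] at this
  have hmid : ∀ i : ℤ, 2 ≤ i → i + 2 ≤ n → f (multPos n s i) = 0 := fun i h1 h2 =>
    eq_zero_of_windows (by omega) (by omega) hA h1 h2
  have hends : f (multPos n s 1) = 0 ∧ f (multPos n s (-1)) = 0 := by
    by_cases hk2 : k = 2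
    · subst hk2
      by_cases hrk : r = multPos n s 2
      · have e1 : f (multPos n s 1) = η * frobPow Fq r (f (multPos n s (-1))) := by
          simpa using hA2'' 1 le_rfl (by omega)
        suffices h1 : f (multPos n s 1) = 0 by
          refine ⟨h1, ?_⟩
          rw [h1] at e1
          simpa [hη, frobPow_eq_zero] using e1.symm
        have e2 : f (multPos n s 3) = -(f (multPos n s 1) * frobPow Fq (multPos n s 1) η) := by
          simpa using hB 3 (by omega) (by omega) 1
        by_cases hn4 : n = 4
        · subst hn4
          have e3 : multPos 4 s 3 = multPos 4 s (-1) := multPos_congr hs (by norm_num)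
          apply eq_zero_of_norm_ne_one Fq hn hs (η := η) (by convert! hnorm; norm_num)
          rw [← e3, e2, hrk, map_neg, map_mul, ← frobPow_add Fq hn, ← multPos_add] at e1
          norm_num at e1
          linear_combination e1
        · rw [hmid 3 (by norm_num) (by omega)] at e2
          simpa [hη, frobPow_eq_zero] using e2.symm
      · simpa using hA2' 1 le_rfl (by omega) hrk
    · constructor
      · have := hA2'' (k - 1) (by omega) (by omega)
        rw [← multPos_congr hs (a := (n : ℤ) - (k - 1 : ℕ))
          (b := -((k - 1 : ℕ) : ℤ)) (by ring),
          hmid (n - (k - 1 : ℕ)) (by omega) (by omega), map_zero, mul_zero] at this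
        rwa [show (k : ℤ) - (k - 1 : ℕ) = 1 by omega] at this
      · have := hA2'' 1 le_rfl (by omega)
        rw [hmid _ (by omega) (by omega)] at this
        simpa [hη, frobPow_eq_zero] using this.symm
  by_cases hi1' : i = 1
  · subst hi1'
    exact_mod_cast hends.1
  by_cases hin' : i = n - 1
  · rw [multPos_congr hs (b := -1) (by omega)]
    exact hends.2
  · exact hmid i (by omega) (by omega)

theorem rightIdealizer_Hcode (hn : Module.finrank Fq F = n) {h : ℤ} (hs : Nat.gcd s n = 1)
    (hk2 : 2 ≤ k) (hk : k + 2 ≤ n) {η : F} (hη : η ≠ 0)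
    (hnorm : Algebra.norm Fq η ≠ (-1 : Fq) ^ (n * k)) (hr : intPos n h = 0)
    {f : Fin n → F} (hf : ∀ g ∈ Hcode Fq n s k h η, qcomp Fq g f ∈ Hcode Fq n s k h η) :
    ∀ i, i ≠ 0 → f i = 0 := by
  have hk1 : 1 ≤ k := by omega
  have hkn : k < n := by omega
  have hA : ∀ j m : ℕ, 1 ≤ j → j < k → k < m → m < n →
      f (multPos n s ((m : ℤ) - j)) = 0 := by
    intro j m hj1 hjk hkm hmn
    have := hf _ (single_mem_Hcode Fq h hs hkn η 1 hj1 hjk)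
    rw [mem_Hcode_iff Fq h hs hk1 hkn] at this
    simpa [qcomp_single_left, multPos_sub, frobPow_eq_zero] using this.1 m hkm hmn
  have hA2 : ∀ j : ℕ, 1 ≤ j → j < k →
      frobPow Fq (multPos n s j) (f (multPos n s ((k : ℤ) - j))) =
      η * frobPow Fq (multPos n s j) (f (multPos n s (-j))) := by
    intro j hj1 hjk
    have := hf _ (single_mem_Hcode Fq h hs hkn η 1 hj1 hjk)
    rw [mem_Hcode_iff Fq h hs hk1 hkn] at this
    have := this.2
    rw [qcomp_single_left, qcomp_single_left, hr, frobPow_zero, ← multPos_zero s, ← multPos_sub,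
      ← multPos_sub, zero_sub, one_mul, one_mul] at this
    exact this
  have hB : ∀ m : ℕ, k < m → m < n →
      f (multPos n s m) =
        -(η * frobPow Fq (multPos n s k) (f (multPos n s ((m : ℤ) - k)))) := by
    intro m hkm hmn
    have := hf _ (twist_mem_Hcode Fq h hs hk1 hkn η 1)
    rw [mem_Hcode_iff Fq h hs hk1 hkn] at this
    have := this.1 m hkm hmn
    rw [qcomp_add_left, Pi.add_apply, qcomp_single_left, qcomp_single_left, sub_zero,
      ← multPos_sub, frobPow_zero, map_one] at this
    linear_combination this
  refine eq_zero_off_zero hs fun i hi1 hin => ?_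
  have hmid : ∀ i : ℤ, 2 ≤ i → i + 2 ≤ n → f (multPos n s i) = 0 := fun i h1 h2 =>
    eq_zero_of_windows (by omega) (by omega) hA h1 h2
  have hends : f (multPos n s 1) = 0 ∧ f (multPos n s (-1)) = 0 := by
    by_cases hk2 : k = 2
    · subst hk2
      have e1 : frobPow Fq (multPos n s 1) (f (multPos n s 1)) =
          η * frobPow Fq (multPos n s 1) (f (multPos n s (-1))) := by
        simpa using hA2 1 le_rfl (by omega)
      suffices h1 : f (multPos n s 1) = 0 by
        refine ⟨h1, ?_⟩
        rw [h1, map_zero] at e1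
        simpa [hη, frobPow_eq_zero] using e1.symm
      have e2 : f (multPos n s 3) = -(η * frobPow Fq (multPos n s 2) (f (multPos n s 1))) := by
        simpa using hB 3 (by omega) (by omega)
      by_cases hn4 : n = 4
      · subst hn4
        have e3 : multPos 4 s 3 = multPos 4 s (-1) := multPos_congr hs (by norm_num)
        apply eq_zero_of_norm_ne_one Fq hn hs (η := η) (by convert! hnorm; norm_num)
        rw [← e3, e2] at e1
        have e4 := congrArg (frobPow Fq (multPos 4 s 3)) e1
        simp only [map_neg, map_mul, ← frobPow_add Fq hn, ← multPos_add] at e4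
        rw [multPos_congr hs (a := 3 + 1) (b := 0) (by norm_num),
          multPos_congr hs (a := 3 + (1 + 2)) (b := 2) (by norm_num), multPos_zero, frobPow_zero,
          frobPow_zero] at e4
        linear_combination e4
      · rw [hmid 3 (by norm_num) (by omega)] at e2
        simpa [hη, frobPow_eq_zero] using e2.symm
    · constructor
      · have := hA2 (k - 1) (by omega) (by omega)
        rw [← multPos_congr hs (a := (n : ℤ) - (k - 1 : ℕ))
          (b := -((k - 1 : ℕ) : ℤ)) (by ring),
          hmid (n - (k - 1 : ℕ)) (by omega) (by omega), map_zero, mul_zero, frobPow_eq_zero] at this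
        rwa [show (k : ℤ) - (k - 1 : ℕ) = 1 by omega] at this
      · have := hA2 1 le_rfl (by omega)
        rw [hmid _ (by omega) (by omega)] at this
        simpa [hη, frobPow_eq_zero] using this.symm
  by_cases hi1' : i = 1
  · subst hi1'
    exact_mod_cast hends.1
  by_cases hin' : i = n - 1
  · rw [multPos_congr hs (b := -1) (by omega)]
    exact hends.2
  · exact hmid i (by omega) (by omega)

theorem not_codeEquiv_Hcode_Gcode (hn : Module.finrank Fq F = n) (h : ℤ) (hs : Nat.gcd s n = 1)
    (hk1 : 1 ≤ k) (hk : k < n) {η : F} (hη : η ≠ 0)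
    (hnorm : Algebra.norm Fq η ≠ (-1 : Fq) ^ (n * k))
    (hext : k = 1 ∨ k = n - 1 → intPos n h ≠ 0 ∧ intPos n h ≠ multPos n s k)
    {t : ℕ} (ht : Nat.gcd t n = 1) : ¬ CodeEquiv Fq (Hcode Fq n s k h η) (Gcode F n t k) := by
  intro hE
  have hk0 : multPos n s k ≠ 0 := by
    rw [← multPos_zero s]
    exact (multPos_ne hs (by omega) (by omega)).symm
  have hr : intPos n h = 0 := by
    obtain ⟨Φ, hΦ, hmem⟩ := hE.exists_injective_leftIdealizer Fq hn ht hk.le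
    apply frobPow_injective Fq hn (F := F)
    ext b
    obtain ⟨c, hc⟩ := exists_eq_single_of_injective hΦ
      (fun b => leftIdealizer_Hcode Fq hn h hs hk1 hk hη hnorm hext (hmem b)) b
    have := hmem c _ (twist_mem_Hcode Fq h hs hk1 hk η 1)
    rw [hc, mem_Hcode_iff Fq h hs hk1 hk] at this
    have := this.2
    simp only [qcomp_single_left, sub_zero, frobPow_zero, Pi.add_apply, Pi.single_eq_same,
      Pi.single_eq_of_ne hk0, Pi.single_eq_of_ne hk0.symm, map_one, mul_one, zero_add, add_zero]
      at this
    rw [frobPow_zero]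
    exact (mul_left_cancel₀ hη (by rw [← this, mul_comm])).symm
  have hk2 : 2 ≤ k ∧ k + 2 ≤ n := by
    by_contra hcon
    exact (hext (by omega)).1 hr
  obtain ⟨Φ, hΦ, hmem⟩ := hE.exists_injective_rightIdealizer Fq hn ht hk.le
  apply hk0
  apply frobPow_injective Fq hn (F := F)
  ext b
  obtain ⟨c, hc⟩ := exists_eq_single_of_injective hΦ
    (fun b => rightIdealizer_Hcode Fq hn hs hk2.1 hk2.2 hη hnorm hr (hmem b)) b
  have := hmem c _ (twist_mem_Hcode Fq h hs hk1 hk η 1)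
  rw [hc, mem_Hcode_iff Fq h hs hk1 hk, hr] at this
  have := this.2
  simp only [qcomp_single_right, sub_zero, frobPow_zero, Pi.add_apply, Pi.single_eq_same,
    Pi.single_eq_of_ne hk0, Pi.single_eq_of_ne hk0.symm, mul_one, zero_add, add_zero, one_mul]
    at this
  rw [frobPow_zero]
  exact mul_left_cancel₀ hη this

end TwistedIdealizers

/-- The Gabidulin index of the generalized twisted Gabidulin code `H_{k,s}(η,h)`, `η ≠ 0`,
equals `k - 1`: the code contains `{a₁x^(q^s) + ⋯ + a_{k-1}x^(q^(s(k-1)))}`, which is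
equivalent to `G_{k-1,s}`, and it contains no subcode equivalent to a generalized Gabidulin
code of dimension `k`. In the extreme dimensions `k = 1` and `k = n - 1` the values
`h ≡ 0, sk (mod n)`, for which `H_{k,s}(η,h)` is itself equivalent to a generalized Gabidulin
code, are excluded. -/
theorem twisted_gabidulin_index
    (Fq F : Type*) [Field Fq] [Fintype Fq] [Field F] [Fintype F] [Algebra Fq F]
    (n s k : ℕ) (h : ℤ) (hn : Module.finrank Fq F = n)
    (hs : 0 < s) (hgcd : Nat.gcd s n = 1) (hk1 : 1 ≤ k) (hkn : k ≤ n - 1)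
    (hext : k = 1 ∨ k = n - 1 →
      ¬ h ≡ 0 [ZMOD (n : ℤ)] ∧ ¬ h ≡ (s : ℤ) * (k : ℤ) [ZMOD (n : ℤ)])
    (η : F) (hη : η ≠ 0) (hnorm : Algebra.norm Fq η ≠ (-1 : Fq) ^ (n * k)) :
    gabidulinIndex Fq (Hcode Fq n s k h η) = k - 1 ∧
    Gshift F n s k ⊆ Hcode Fq n s k h η ∧
    CodeEquiv Fq (Gshift F n s k) (Gcode F n s (k - 1)) ∧
    ¬ ContainsGabidulin Fq (Hcode Fq n s k h η) k := by
  have hn0 : NeZero n := ⟨by omega⟩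
  have hk : k < n := by omega
  have hsub := Gshift_subset_Hcode Fq h hgcd hk1 hk η (F := F)
  have hequiv := codeEquiv_Gshift_Gcode Fq hgcd hk1 hk (F := F)
  have hext' : k = 1 ∨ k = n - 1 → intPos n h ≠ 0 ∧ intPos n h ≠ multPos n s k := by
    rwa [Ne, Ne, ← intPos_zero, ← intPos_mul, intPos_eq_iff, intPos_eq_iff]
  have hnot : ¬ ContainsGabidulin Fq (Hcode Fq n s k h η) k := by
    rintro ⟨G, hG, t, ht, hGE⟩
    rw [(le_and_eq_of_subset_of_codeEquiv Fq ht hk.le (ncard_Hcode_le Fq s k h η) hG hGE).2 rfl]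
      at hGE
    exact not_codeEquiv_Hcode_Gcode Fq hn h hgcd hk1 hk hη hnorm hext' ht hGE
  refine ⟨?_, hsub, hequiv, hnot⟩
  refine IsGreatest.csSup_eq ⟨⟨by omega, _, hsub, s, hgcd, hequiv⟩, ?_⟩
  rintro d ⟨hdn, hd⟩
  obtain ⟨G, hG, t, ht, hGE⟩ := id hd
  have hdk := (le_and_eq_of_subset_of_codeEquiv Fq ht (by omega)
    (ncard_Hcode_le Fq s k h η) hG hGE).1
  have : d ≠ k := by
    rintro rfl
    exact hnot hd
  omega
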